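/- Let α ∈ ℂ satisfy 7α³ + 7α + 1 = 0 and let S_α := P − U_{a₁,…,a₅} with a₁ := −(12/7)α² − (384/49)α − 8/7, a₂ := −(32/7)α² + (24/49)α − 4, a₃ := −4α² + (24/49)α − 4, a₄ := −(8/7)α² + (8/49)α − 8/7, a₅ := 49α² − 7α + 50. Then the surface {S_α = 0} in ℙ³(ℂ) has exactly 99 singular points, and every one of them is a node (ordinary double point). -/

import Mathlib

open MvPolynomial

/-- The septic `P(x,y,z,w)` (variables `X 0 = x, X 1 = y, X 2 = z, X 3 = w`). -/
noncomputable def Psept : MvPolynomial (Fin 4) ℂ :=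
  X 0 * ((X 0) ^ 6 - 21 * (X 0) ^ 4 * (X 1) ^ 2 + 35 * (X 0) ^ 2 * (X 1) ^ 4
      - 7 * (X 1) ^ 6)
    + 7 * X 2 * (((X 0) ^ 2 + (X 1) ^ 2) ^ 3
        - 8 * (X 2) ^ 2 * ((X 0) ^ 2 + (X 1) ^ 2) ^ 2
        + 16 * (X 2) ^ 4 * ((X 0) ^ 2 + (X 1) ^ 2))
    - 64 * (X 2) ^ 7

/-- `U_{a₁,…,a₅}(x,y,z,w) = (z + a₅w)(a₁z³ + a₂z²w + a₃zw² + a₄w³ + (z+w)(x²+y²))²`. -/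
noncomputable def Usept (a₁ a₂ a₃ a₄ a₅ : ℂ) : MvPolynomial (Fin 4) ℂ :=
  (X 2 + C a₅ * X 3) *
    (C a₁ * (X 2) ^ 3 + C a₂ * (X 2) ^ 2 * X 3 + C a₃ * X 2 * (X 3) ^ 2
        + C a₄ * (X 3) ^ 3 + (X 2 + X 3) * ((X 0) ^ 2 + (X 1) ^ 2)) ^ 2

/-- All partial derivatives of `F` vanish at `v`. -/
def VanishingJacobianAt {n : ℕ} (F : MvPolynomial (Fin n) ℂ) (v : Fin n → ℂ) : Prop :=
  ∀ i, eval v (pderiv i F) = 0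

/-- The Hessian matrix `(∂²F/∂xᵢ∂xⱼ)(v)`. -/
noncomputable def hessianAt {n : ℕ} (F : MvPolynomial (Fin n) ℂ) (v : Fin n → ℂ) :
    Matrix (Fin n) (Fin n) ℂ :=
  Matrix.of fun i j => eval v (pderiv i (pderiv j F))

/-- A point of ℙ³(ℂ) is a singular point of `{F = 0}` if it is represented by a
nonzero vector at which all four partial derivatives of `F` vanish. -/
def IsSingularPoint (F : MvPolynomial (Fin 4) ℂ)
    (p : Projectivization ℂ (Fin 4 → ℂ)) : Prop :=
  ∃ v : Fin 4 → ℂ, ∃ hv : v ≠ 0, Projectivization.mk ℂ v hv = p ∧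
    VanishingJacobianAt F v

/-- A point of ℙ³(ℂ) is a node of `{F = 0}` if it is represented by a nonzero
vector at which all partial derivatives of `F` vanish and the 4×4 Hessian matrix
has rank 3. -/
def IsNode (F : MvPolynomial (Fin 4) ℂ)
    (p : Projectivization ℂ (Fin 4 → ℂ)) : Prop :=
  ∃ v : Fin 4 → ℂ, ∃ hv : v ≠ 0, Projectivization.mk ℂ v hv = p ∧
    VanishingJacobianAt F v ∧ (hessianAt F v).rank = 3


/-! ### Pure algebra: the plane section in the coordinates `(c, n)` with `z = 1` -/

/-- The cubic whose roots give the three double lines. -/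
def qq (c : ℂ) : ℂ := c ^ 3 + 4 * c ^ 2 - 4 * c - 8
def qt (c : ℂ) : ℂ := c ^ 3 - 2 * c ^ 2 - 8 * c + 8
def qf (c : ℂ) : ℂ := 5 * c ^ 2 - 2 * c - 4

def RR (s z n : ℂ) : ℂ := 7 * n * s - 8 * n ^ 3 - 4 * n ^ 2 * z + 4 * n * z ^ 2 + 8 * z ^ 3
def RRn (s z n : ℂ) : ℂ := 7 * s - 24 * n ^ 2 - 8 * n * z + 4 * z ^ 2
def RRz (_s z n : ℂ) : ℂ := -4 * n ^ 2 + 8 * n * z + 24 * z ^ 2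
def Gs (s z n : ℂ) : ℂ :=
  7 * z * (3 * s ^ 2 - 16 * z ^ 2 * s + 16 * z ^ 4) - 14 * n * (n - z) * RR s z n
def Gn (s z n : ℂ) : ℂ := -(RR s z n * (RR s z n + 2 * (n - z) * RRn s z n))
def Gz (s z n : ℂ) : ℂ :=
  7 * (s ^ 3 - 24 * z ^ 2 * s ^ 2 + 80 * z ^ 4 * s) - 448 * z ^ 6 + RR s z n ^ 2
    - 2 * (n - z) * RR s z n * RRz s z n
def Gss (s z n : ℂ) : ℂ := 7 * z * (6 * s - 16 * z ^ 2) - 98 * n ^ 2 * (n - z)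
def Gsn (s z n : ℂ) : ℂ := -14 * ((2 * n - z) * RR s z n + n * (n - z) * RRn s z n)
def Gnn (s z n : ℂ) : ℂ :=
  -(RRn s z n * (RR s z n + 2 * (n - z) * RRn s z n)
    + RR s z n * (3 * RRn s z n + 2 * (n - z) * (-48 * n - 8 * z)))

/-- The fourteen base points. -/
def Base (c n : ℂ) : Prop :=
  (qq c = 0 ∧ RR (c ^ 2) 1 n = 0) ∨ (qf c = 0 ∧ n = c) ∨ (qt c = 0 ∧ n = c ^ 2 / 4 - 1)

lemma elim_aux (x n : ℂ) (hx : x ≠ 0)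
    (h1 : x ^ 2 * (3 * n - 2) = 4 * n * (2 * n + 1) * (n - 1))
    (h2 : 7 * x ^ 5 + 42 * x ^ 4 - 224 * x ^ 2 + 224
      = 28 * n * (n - 1) * (7 * n * x ^ 2 - 8 * n ^ 3 - 4 * n ^ 2 + 4 * n + 8))
    (h3 : x ^ 7 + 7 * x ^ 6 - 56 * x ^ 4 + 112 * x ^ 2 - 64
      = (n - 1) * (7 * n * x ^ 2 - 8 * n ^ 3 - 4 * n ^ 2 + 4 * n + 8) ^ 2) :
    (qf x = 0 ∧ n = x) ∨ (qt x = 0 ∧ n = x ^ 2 / 4 - 1) := by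
  have hL : 3 * n - 2 ≠ 0 := by
    intro h
    have hn : n = 2 / 3 := by linear_combination h / 3
    subst hn
    norm_num at h1
  have hN : 4 * n * (2 * n + 1) * (n - 1) ≠ 0 := by
    rw [← h1]; exact mul_ne_zero (pow_ne_zero _ hx) hL
  have hn0 : n ≠ 0 := by
    rintro rfl; simp at hN
  have hX : 7 * x * (x ^ 2 * (3 * n - 2)) ^ 2
      = 28 * n * (n - 1) * (7 * n * (x ^ 2 * (3 * n - 2))
          + (-8 * n ^ 3 - 4 * n ^ 2 + 4 * n + 8) * (3 * n - 2)) * (3 * n - 2)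
        - 42 * (x ^ 2 * (3 * n - 2)) ^ 2 + 224 * (x ^ 2 * (3 * n - 2)) * (3 * n - 2)
        - 224 * (3 * n - 2) ^ 2 := by
    linear_combination (3 * n - 2) ^ 2 * h2
  have hF : 7 * x * (x ^ 2 * (3 * n - 2)) ^ 2 * (x ^ 2 * (3 * n - 2))
      = 7 * ((n - 1) * (7 * n * (x ^ 2 * (3 * n - 2))
          + (-8 * n ^ 3 - 4 * n ^ 2 + 4 * n + 8) * (3 * n - 2)) ^ 2 * (3 * n - 2)
        - 7 * (x ^ 2 * (3 * n - 2)) ^ 3 + 56 * (x ^ 2 * (3 * n - 2)) ^ 2 * (3 * n - 2)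
        - 112 * (x ^ 2 * (3 * n - 2)) * (3 * n - 2) ^ 2 + 64 * (3 * n - 2) ^ 3) := by
    linear_combination 7 * (3 * n - 2) ^ 3 * h3
  have hQ : (7 * x * (x ^ 2 * (3 * n - 2)) ^ 2) ^ 2 * (3 * n - 2)
      = 49 * (x ^ 2 * (3 * n - 2)) ^ 5 := by ring
  rw [h1] at hX hF hQ
  have h9 : n * (5 * n ^ 2 - 2 * n - 4) * (n ^ 3 - 2 * n ^ 2 - n + 1)
      * (4 * n ^ 3 - n ^ 2 - 9 * n + 5) = 0 := by
    rw [hX] at hF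
    linear_combination hF / 448
  rw [hX] at hQ
  rcases mul_eq_zero.mp h9 with h9 | h9
  · rcases mul_eq_zero.mp h9 with h9 | h9
    · left
      have h9 := (mul_eq_zero.mp h9).resolve_left hn0
      have : (x - n) * (4 * n * (2 * n + 1) * (n - 1)) ^ 2 = 0 := by
        linear_combination hX / 7 + (448 * n ^ 5 - 1568 * n ^ 4 + 1232 * n ^ 3 + 896 * n ^ 2
          - 1008 * n + 224) / 7 * h9
      have hxn : x = n :=
        sub_eq_zero.mp ((mul_eq_zero.mp this).resolve_right (pow_ne_zero _ hN))
      subst hxn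
      exact ⟨h9, rfl⟩
    · right
      have : (x - (2 * n ^ 2 - 2 * n - 2)) * (4 * n * (2 * n + 1) * (n - 1)) ^ 2 = 0 := by
        linear_combination hX / 7 + (-896 * n ^ 5 + 2688 * n ^ 4 - 4032 * n ^ 3 + 672 * n ^ 2
          + 2688 * n - 896) / 7 * h9
      have hxn : x = 2 * n ^ 2 - 2 * n - 2 :=
        sub_eq_zero.mp ((mul_eq_zero.mp this).resolve_right (pow_ne_zero _ hN))
      subst hxn
      constructor
      · unfold qt
        linear_combination (8 * n ^ 3 - 8 * n ^ 2 - 16 * n + 8) * h9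
      · linear_combination (-n) * h9
  · exfalso
    have : (1149239046807161856 : ℂ) = 0 := by
      linear_combination (1574047184126420 * n ^ 2 + 580109202924527 * n - 3182272623845318) * hQ
        + (-7897939151072724992000 * n ^ 14 + 57508478569112239513600 * n ^ 13
          - 148354158411741944273920 * n ^ 12 + 108740685765444309785600 * n ^ 11
          + 196877082315450038792192 * n ^ 10 - 405509308123869007091712 * n ^ 9
          + 91197531256473329114112 * n ^ 8 + 329270443396937804131328 * n ^ 7
          - 244338496884597776252928 * n ^ 6 - 66190525308068241733632 * n ^ 5
          + 121496199133982618688512 * n ^ 4 - 23282181234701394267136 * n ^ 3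
          - 16604288011645495318528 * n ^ 2 + 8055422592656682077184 * n
          - 1021681903704639693824) * h9
    norm_num at this

lemma qq_ne {c : ℂ} (h : qq c = 0) : c ≠ 0 := by
  rintro rfl; simp [qq] at h
lemma qt_ne {c : ℂ} (h : qt c = 0) : c ≠ 0 := by
  rintro rfl; simp [qt] at h
lemma qf_ne {c : ℂ} (h : qf c = 0) : c ≠ 0 := by
  rintro rfl; simp [qf] at h
lemma Base.ne {c n : ℂ} (h : Base c n) : c ≠ 0 := by
  rcases h with h | h | h
  exacts [qq_ne h.1, qf_ne h.1, qt_ne h.1]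

/-- The equations in the plane section. -/
def PlaneSing (c n : ℂ) : Prop :=
  7 * c ^ 5 + 2 * Gs (c ^ 2) 1 n = 0 ∧ Gz (c ^ 2) 1 n = 0 ∧ Gn (c ^ 2) 1 n = 0

lemma base_sing {c n : ℂ} (h : Base c n) : PlaneSing c n := by
  rcases h with ⟨h, h'⟩ | ⟨h, rfl⟩ | ⟨h, rfl⟩
  · refine ⟨?_, ?_, ?_⟩
    · unfold Gs; rw [h']; unfold qq at h
      linear_combination (7 * c ^ 2 + 14 * c - 28) * h
    · unfold Gz; rw [h']; unfold qq at h
      linear_combination (7 * (c ^ 3 - 4 * c ^ 2 - 4 * c + 8)) * h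
    · unfold Gn; rw [h']; ring
  · unfold qf at h
    refine ⟨?_, ?_, ?_⟩
    · unfold Gs RR
      linear_combination (7 * n ^ 3 + 28 * n ^ 2 - 28 * n - 56) * h
    · unfold Gz RR RRz; ring
    · unfold Gn RR RRn
      linear_combination (-7 * n ^ 4 - 28 * n ^ 3 + 28 * n ^ 2 + 56 * n) * h
  · unfold qt at h
    refine ⟨?_, ?_, ?_⟩
    · unfold Gs RR
      linear_combination (7 / 32 * c ^ 7 + 7 / 16 * c ^ 6 - 21 / 4 * c ^ 5 - 35 / 4 * c ^ 4
        + 49 / 2 * c ^ 3 + 28 * c ^ 2 - 28 * c - 28) * h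
    · unfold Gz RR RRz; ring
    · unfold Gn RR RRn
      linear_combination (-7 / 64 * c ^ 9 - 7 / 32 * c ^ 8 + 7 / 2 * c ^ 7 + 49 / 8 * c ^ 6
        - 119 / 4 * c ^ 5 - 77 / 2 * c ^ 4 + 77 * c ^ 3 + 84 * c ^ 2 - 56 * c - 56) * h

lemma sing_base {c n : ℂ} (hc : c ≠ 0) (h : PlaneSing c n) : Base c n := by
  obtain ⟨h1, h2, h3⟩ := h
  have hf : c ^ 7 + 7 * c ^ 6 - 56 * c ^ 4 + 112 * c ^ 2 - 64
      = (n - 1) * RR (c ^ 2) 1 n ^ 2 := by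
    unfold Gs at h1; unfold Gz at h2; unfold Gn at h3
    unfold RR RRn RRz at *
    linear_combination (c ^ 2 * h1 + h2 + n * h3) / 7
  by_cases hR : RR (c ^ 2) 1 n = 0
  · left
    refine ⟨?_, hR⟩
    rw [hR] at hf
    have hf' : (c - 1) * qq c ^ 2 = 0 := by unfold qq; linear_combination hf
    rcases mul_eq_zero.mp hf' with h | h
    · have : c = 1 := sub_eq_zero.mp h
      subst this
      unfold Gs at h1; rw [hR] at h1
      norm_num at h1
    · exact pow_eq_zero_iff (two_ne_zero) |>.mp h
  · right
    have h3' : RR (c ^ 2) 1 n + 2 * (n - 1) * RRn (c ^ 2) 1 n = 0 := by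
      unfold Gn at h3
      exact (mul_eq_zero.mp (neg_eq_zero.mp h3)).resolve_left hR
    apply elim_aux c n hc
    · unfold RR RRn at h3'; linear_combination h3' / 7
    · unfold Gs RR at h1; linear_combination h1
    · unfold RR at hf; linear_combination hf

lemma RRn_ne {c n : ℂ} (h : qq c = 0) (h' : RR (c ^ 2) 1 n = 0) : RRn (c ^ 2) 1 n ≠ 0 := by
  intro h0
  have e1 : 4 * n ^ 3 + n ^ 2 + 2 = 0 := by
    unfold RR at h'; unfold RRn at h0; linear_combination (h' - n * h0) / 4
  have e2 : (c ^ 2) ^ 3 - 24 * (c ^ 2) ^ 2 + 80 * c ^ 2 - 64 = 0 := by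
    unfold qq at h; linear_combination (c ^ 3 - 4 * c ^ 2 - 4 * c + 8) * h
  have e3 : c ^ 2 = (24 * n ^ 2 + 8 * n - 4) / 7 := by
    unfold RRn at h0; linear_combination h0 / 7
  rw [e3] at e2
  have : (6236321728 : ℂ) = 0 := by
    linear_combination 343 * (-2814736 * n ^ 2 + 1717752 * n - 1577297) * e2
      + (9727727616 * n ^ 5 + 1359244800 * n ^ 4 - 70540604928 * n ^ 3 + 12489355520 * n ^ 2
        + 68199255040 * n - 28730620160) * e1
  norm_num at this

lemma hess_ne {c n : ℂ} (h : Base c n) :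
    Gnn (c ^ 2) 1 n * (35 * c ^ 3 + 4 * Gss (c ^ 2) 1 n) - 4 * Gsn (c ^ 2) 1 n ^ 2 ≠ 0 := by
  rcases h with ⟨h, h'⟩ | ⟨h, rfl⟩ | ⟨h, rfl⟩
  · have hn := RRn_ne h h'
    have hc := qq_ne h
    have hn1 : n - 1 ≠ 0 := by
      intro h0
      have : n = 1 := sub_eq_zero.mp h0
      subst this
      unfold RR at h'
      apply hc
      have : c ^ 2 = 0 := by linear_combination h' / 7
      exact pow_eq_zero_iff (two_ne_zero) |>.mp this
    have hc1 : c - 1 ≠ 0 := by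
      intro h0
      have : c = 1 := sub_eq_zero.mp h0
      subst this
      norm_num [qq] at h
    have hc6 : c + 6 ≠ 0 := by
      intro h0
      have : c = -6 := eq_neg_of_add_eq_zero_left h0
      subst this
      norm_num [qq] at h
    have key : Gnn (c ^ 2) 1 n * (35 * c ^ 3 + 4 * Gss (c ^ 2) 1 n) - 4 * Gsn (c ^ 2) 1 n ^ 2
        = -56 * (n - 1) * RRn (c ^ 2) 1 n ^ 2 * (c - 1) * (c + 6) := by
      unfold Gnn Gss Gsn
      rw [h']
      generalize RRn (c ^ 2) 1 n = r
      unfold qq at h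
      linear_combination (-70 * (n - 1) * r ^ 2) * h
    rw [key]
    simp [hn, hn1, hc1, hc6]
  · intro h0
    unfold qf at h
    unfold Gnn Gss Gsn RRn RR at h0
    have : (885631488 : ℂ) = 0 := by
      linear_combination (6705 * n - 13292) * h0 + (24312330 * n ^ 7 + 164043278 * n ^ 6
        - 89308772 * n ^ 5 - 1606823680 * n ^ 4 + 1135179472 * n ^ 3 + 2132777920 * n ^ 2
        - 1055699904 * n - 388142720) * h
    norm_num at this
  · intro h0
    unfold qt at h
    unfold Gnn Gss Gsn RRn RR at h0
    have : (949731328 : ℂ) = 0 := by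
      linear_combination (-5264 * c ^ 2 + 6144 * c + 46144) * h0
        + (-16121 * c ^ 15 - 13426 * c ^ 14 + 1049482 * c ^ 13 + 395038 * c ^ 12
          - 27648544 * c ^ 11 - 7281792 * c ^ 10 + 367942176 * c ^ 9 + 145959240 * c ^ 8
          - 2589554352 * c ^ 7 - 1584304064 * c ^ 6 + 9093343168 * c ^ 5 + 7047739776 * c ^ 4
          - 14078494976 * c ^ 3 - 11963488768 * c ^ 2 + 7005673472 * c + 6196434944) * h
    norm_num at this

/-! ### Counting -/

lemma exists_roots_finset (p : Polynomial ℂ) (d : ℕ) (hd : p.natDegree = d) (hp : p ≠ 0)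
    (hs : ∀ x, p.eval x = 0 → p.derivative.eval x ≠ 0) :
    ∃ s : Finset ℂ, s.card = d ∧ ∀ x, x ∈ s ↔ p.eval x = 0 := by
  refine ⟨p.roots.toFinset, ?_, ?_⟩
  · have hnd : p.roots.Nodup := by
      rw [Multiset.nodup_iff_count_le_one]
      intro x
      rw [Polynomial.count_roots]
      by_contra! hlt
      rw [Polynomial.one_lt_rootMultiplicity_iff_isRoot hp] at hlt
      exact hs x hlt.1 hlt.2
    rw [Multiset.toFinset_card_of_nodup hnd, ← hd]
    exact (IsAlgClosed.splits p).natDegree_eq_card_roots.symm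
  · intro x
    simp [hp, Polynomial.IsRoot]

lemma exists_cubic_finset (a b c d : ℂ) (ha : a ≠ 0)
    (hs : ∀ x, a * x ^ 3 + b * x ^ 2 + c * x + d = 0 → 3 * a * x ^ 2 + 2 * b * x + c ≠ 0) :
    ∃ s : Finset ℂ, s.card = 3 ∧ ∀ x, x ∈ s ↔ a * x ^ 3 + b * x ^ 2 + c * x + d = 0 := by
  have hd : (Polynomial.C a * Polynomial.X ^ 3 + Polynomial.C b * Polynomial.X ^ 2
      + Polynomial.C c * Polynomial.X + Polynomial.C d).natDegree = 3 :=
    Polynomial.natDegree_cubic ha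
  obtain ⟨s, h1, h2⟩ := exists_roots_finset _ 3 hd
    (by intro h; rw [h] at hd; simp at hd)
    (by
      intro x hx hx'
      simp at hx hx'
      exact hs x hx (by linear_combination hx'))
  exact ⟨s, h1, fun x => by rw [h2]; simp⟩

lemma exists_quadratic_finset (b c d : ℂ) (ha : b ≠ 0)
    (hs : ∀ x, b * x ^ 2 + c * x + d = 0 → 2 * b * x + c ≠ 0) :
    ∃ s : Finset ℂ, s.card = 2 ∧ ∀ x, x ∈ s ↔ b * x ^ 2 + c * x + d = 0 := by
  have hd : (Polynomial.C b * Polynomial.X ^ 2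
      + Polynomial.C c * Polynomial.X + Polynomial.C d).natDegree = 2 :=
    Polynomial.natDegree_quadratic ha
  obtain ⟨s, h1, h2⟩ := exists_roots_finset _ 2 hd
    (by intro h; rw [h] at hd; simp at hd)
    (by
      intro x hx hx'
      simp at hx hx'
      exact hs x hx (by linear_combination hx'))
  exact ⟨s, h1, fun x => by rw [h2]; simp⟩

lemma exists_base9 : ∃ s : Finset (ℂ × ℂ), s.card = 9 ∧
    ∀ p, p ∈ s ↔ (qq p.1 = 0 ∧ RR (p.1 ^ 2) 1 p.2 = 0) := by
  classical
  obtain ⟨sq, hsq, hsq'⟩ := exists_cubic_finset 1 4 (-4) (-8) one_ne_zero (by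
    intro c h1 h2
    have : (56 : ℂ) = 0 := by
      linear_combination (c ^ 2 + 3 * c - 4) * h2 + (-3 * c - 5) * h1
    norm_num at this)
  have hq : ∀ c, c ∈ sq ↔ qq c = 0 := by
    intro c; rw [hsq']; unfold qq
    constructor <;> intro h <;> linear_combination h
  have ht : ∀ c : ℂ, ∃ t : Finset ℂ, qq c = 0 →
      (t.card = 3 ∧ ∀ n, n ∈ t ↔ RR (c ^ 2) 1 n = 0) := by
    intro c
    by_cases hc : qq c = 0
    · obtain ⟨t, h1, h2⟩ := exists_cubic_finset (-8) (-4) (7 * c ^ 2 + 4) 8 (by norm_num) (by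
        intro n e1 e2
        have e1' : RR (c ^ 2) 1 n = 0 := by unfold RR; linear_combination e1
        apply RRn_ne hc e1'
        unfold RRn; linear_combination e2)
      refine ⟨t, fun _ => ⟨h1, fun n => ?_⟩⟩
      rw [h2]; unfold RR
      constructor <;> intro h <;> linear_combination h
    · exact ⟨∅, fun h => absurd h hc⟩
  choose t ht using ht
  refine ⟨(sq.sigma t).map (Equiv.sigmaEquivProd ℂ ℂ).toEmbedding, ?_, ?_⟩
  · rw [Finset.card_map, Finset.card_sigma, Finset.sum_congr rfl
      (fun c hc => (ht c ((hq c).mp hc)).1)]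
    simp [hsq]
  · rintro ⟨c, n⟩
    simp only [Finset.mem_map_equiv, Equiv.sigmaEquivProd_symm_apply, Finset.mem_sigma, hq]
    constructor
    · rintro ⟨h1, h2⟩; exact ⟨h1, ((ht c h1).2 n).mp h2⟩
    · rintro ⟨h1, h2⟩; exact ⟨h1, ((ht c h1).2 n).mpr h2⟩

lemma exists_base14 : ∃ s : Finset (ℂ × ℂ), s.card = 14 ∧ ∀ p, p ∈ s ↔ Base p.1 p.2 := by
  classical
  obtain ⟨s9, h9, h9'⟩ := exists_base9
  obtain ⟨s2, h2, h2'⟩ := exists_quadratic_finset 5 (-2) (-4) (by norm_num) (by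
    intro c e1 e2
    have : (42 : ℂ) = 0 := by linear_combination (5 * c - 1) * e2 - 10 * e1
    norm_num at this)
  obtain ⟨s3, h3, h3'⟩ := exists_cubic_finset 1 (-2) (-8) 8 one_ne_zero (by
    intro c e1 e2
    have : (56 : ℂ) = 0 := by
      linear_combination (c ^ 2 - c - 6) * e2 + (-3 * c + 1) * e1
    norm_num at this)
  have hi2 : Function.Injective (fun c : ℂ => (c, c)) := fun a b h => (Prod.ext_iff.mp h).1
  have hi3 : Function.Injective (fun c : ℂ => (c, c ^ 2 / 4 - 1)) :=
    fun a b h => (Prod.ext_iff.mp h).1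
  have m2 : ∀ p, p ∈ s2.image (fun c : ℂ => (c, c)) ↔ (qf p.1 = 0 ∧ p.2 = p.1) := by
    rintro ⟨c, n⟩
    simp only [Finset.mem_image, h2', Prod.mk.injEq, qf]
    constructor
    · rintro ⟨a, h, rfl, rfl⟩; exact ⟨by linear_combination h, rfl⟩
    · rintro ⟨h, rfl⟩; exact ⟨_, by linear_combination h, rfl, rfl⟩
  have m3 : ∀ p, p ∈ s3.image (fun c : ℂ => (c, c ^ 2 / 4 - 1)) ↔
      (qt p.1 = 0 ∧ p.2 = p.1 ^ 2 / 4 - 1) := by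
    rintro ⟨c, n⟩
    simp only [Finset.mem_image, h3', Prod.mk.injEq, qt]
    constructor
    · rintro ⟨a, h, rfl, rfl⟩; exact ⟨by linear_combination h, rfl⟩
    · rintro ⟨h, rfl⟩; exact ⟨_, by linear_combination h, rfl, rfl⟩
  have d23 : Disjoint (s2.image (fun c : ℂ => (c, c)))
      (s3.image (fun c : ℂ => (c, c ^ 2 / 4 - 1))) := by
    rw [Finset.disjoint_left]
    rintro ⟨c, n⟩ ha hb
    have e1 := ((m2 _).mp ha).1
    have e2 := ((m3 _).mp hb).1
    simp only [qf, qt] at e1 e2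
    have : (112 : ℂ) = 0 := by
      linear_combination (-35 * c - 16) * e2 + (7 * c ^ 2 - 8 * c - 60) * e1
    norm_num at this
  have d9 : Disjoint s9 (s2.image (fun c : ℂ => (c, c)) ∪
      s3.image (fun c : ℂ => (c, c ^ 2 / 4 - 1))) := by
    rw [Finset.disjoint_left]
    rintro ⟨c, n⟩ ha hb
    have e0 := ((h9' _).mp ha).1
    rcases Finset.mem_union.mp hb with hb | hb
    · have e1 := ((m2 _).mp hb).1
      simp only [qf, qq] at e0 e1
      have : (656 : ℂ) = 0 := by
        linear_combination (45 * c - 158) * e0 + (-9 * c ^ 2 - 8 * c + 152) * e1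
      norm_num at this
    · have e1 := ((m3 _).mp hb).1
      simp only [qt, qq] at e0 e1
      have : (208 : ℂ) = 0 := by
        linear_combination (4 * c ^ 2 - 7 * c - 24) * e0 + (-4 * c ^ 2 - 17 * c + 2) * e1
      norm_num at this
  refine ⟨s9 ∪ (s2.image (fun c : ℂ => (c, c)) ∪
      s3.image (fun c : ℂ => (c, c ^ 2 / 4 - 1))), ?_, ?_⟩
  · rw [Finset.card_union_of_disjoint d9, Finset.card_union_of_disjoint d23,
      Finset.card_image_of_injective _ hi2, Finset.card_image_of_injective _ hi3, h9, h2, h3]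
  · intro p
    rw [Finset.mem_union, Finset.mem_union, h9', m2, m3]
    rfl

/-- The equations for a singular point with `z` arbitrary, in the coordinates
`u = x + i y`, `v = x - i y`, `z`, `n`. -/
def Sing (u v z n : ℂ) : Prop :=
  7 * u ^ 6 + 2 * v * Gs (u * v) z n = 0 ∧ 7 * v ^ 6 + 2 * u * Gs (u * v) z n = 0 ∧
    Gz (u * v) z n = 0 ∧ Gn (u * v) z n = 0

lemma Sing.cases {u v n : ℂ} (h : Sing u v 1 n) :
    (u = 0 ∧ v = 0 ∧ n = 0) ∨ ∃ c ζ, Base c n ∧ ζ ^ 7 = 1 ∧ u = c * ζ ∧ v = c * ζ ^ 6 := by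
  obtain ⟨h1, h2, h3, h4⟩ := h
  by_cases hu : u = 0
  · have hv : v = 0 := by
      subst hu
      have : v ^ 6 = 0 := by linear_combination h2 / 7
      exact pow_eq_zero_iff (by norm_num) |>.mp this
    left
    subst hu hv
    refine ⟨rfl, rfl, ?_⟩
    unfold Gz at h3; unfold Gn at h4; unfold RR RRn RRz at *
    -- `Gz = 0`, `Gn = 0` on the axis
    have hf : (n - 1) * (-8 * n ^ 3 - 4 * n ^ 2 + 4 * n + 8) ^ 2 + 64 = 0 := by
      linear_combination -(h3 + n * h4) / 7
    have hE : (-8 * n ^ 3 - 4 * n ^ 2 + 4 * n + 8) * (n * ((2 * n + 1) * (n - 1))) = 0 := by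
      linear_combination h4 / 28
    rcases mul_eq_zero.mp hE with h | h
    · rw [h] at hf; norm_num at hf
    rcases mul_eq_zero.mp h with h | h
    · exact h
    rcases mul_eq_zero.mp h with h | h
    · have : n = -1 / 2 := by linear_combination h / 2
      subst this; norm_num at hf
    · have : n = 1 := by linear_combination h
      subst this; norm_num at hf
  · have hv : v ≠ 0 := by
      rintro rfl
      have : u ^ 6 = 0 := by linear_combination h1 / 7
      exact hu (pow_eq_zero_iff (by norm_num) |>.mp this)
    right
    have h7 : u ^ 7 = v ^ 7 := by linear_combination (u * h1 - v * h2) / 7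
    have hc2 : (u ^ 4 / v ^ 3) ^ 2 = u * v := by
      field_simp
      linear_combination h7
    have hc : u ^ 4 / v ^ 3 ≠ 0 := div_ne_zero (pow_ne_zero _ hu) (pow_ne_zero _ hv)
    have hc7 : (u ^ 4 / v ^ 3) ^ 7 = u ^ 7 := by
      field_simp
      linear_combination (u ^ 14 + u ^ 7 * v ^ 7 + v ^ 14) * h7
    refine ⟨u ^ 4 / v ^ 3, v ^ 3 / u ^ 3, ?_, ?_, ?_, ?_⟩
    · apply sing_base hc
      refine ⟨?_, by rw [hc2]; exact h3, by rw [hc2]; exact h4⟩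
      have : (u ^ 4 / v ^ 3) ^ 2 *
          (7 * (u ^ 4 / v ^ 3) ^ 5 + 2 * Gs ((u ^ 4 / v ^ 3) ^ 2) 1 n) = 0 := by
        have e : (u ^ 4 / v ^ 3) ^ 2 *
          (7 * (u ^ 4 / v ^ 3) ^ 5 + 2 * Gs ((u ^ 4 / v ^ 3) ^ 2) 1 n)
            = 7 * (u ^ 4 / v ^ 3) ^ 7
              + 2 * (u ^ 4 / v ^ 3) ^ 2 * Gs ((u ^ 4 / v ^ 3) ^ 2) 1 n := by ring
        rw [e, hc7, hc2]
        linear_combination u * h1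
      exact (mul_eq_zero.mp this).resolve_left (pow_ne_zero _ hc)
    · field_simp
      linear_combination -(u ^ 14 + u ^ 7 * v ^ 7 + v ^ 14) * h7
    · field_simp
    · field_simp
      linear_combination (u ^ 7 + v ^ 7) * h7

lemma Sing.of_axis : Sing 0 0 1 0 := by
  refine ⟨?_, ?_, ?_, ?_⟩ <;> norm_num [Gs, Gz, Gn, RR, RRn, RRz]

lemma Sing.of_base {c n ζ : ℂ} (hb : Base c n) (hζ : ζ ^ 7 = 1) :
    Sing (c * ζ) (c * ζ ^ 6) 1 n := by
  obtain ⟨h1, h2, h3⟩ := base_sing hb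
  have hs : c * ζ * (c * ζ ^ 6) = c ^ 2 := by linear_combination c ^ 2 * hζ
  unfold Sing
  rw [hs]
  refine ⟨?_, ?_, h2, h3⟩
  · linear_combination c * ζ ^ 6 * h1
  · linear_combination c * ζ * h1 + 7 * c ^ 6 * ζ * (ζ ^ 28 + ζ ^ 21 + ζ ^ 14 + ζ ^ 7 + 1) * hζ

lemma sing_ncard : {p : ℂ × ℂ × ℂ | Sing p.1 p.2.1 1 p.2.2}.ncard = 99 := by
  classical
  obtain ⟨s, hs, hs'⟩ := exists_base14
  have hζ : (Polynomial.nthRootsFinset 7 (1 : ℂ)).card = 7 :=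
    (Complex.isPrimitiveRoot_exp 7 (by norm_num)).card_nthRootsFinset
  have hm : ∀ z : ℂ, z ∈ Polynomial.nthRootsFinset 7 (1 : ℂ) ↔ z ^ 7 = 1 := fun z =>
    Polynomial.mem_nthRootsFinset (by norm_num) 1
  set φ : (ℂ × ℂ) × ℂ → ℂ × ℂ × ℂ := fun p => (p.1.1 * p.2, p.1.1 * p.2 ^ 6, p.1.2) with hφ
  have hset : {p : ℂ × ℂ × ℂ | Sing p.1 p.2.1 1 p.2.2}
      = ((insert (0, 0, 0) ((s ×ˢ Polynomial.nthRootsFinset 7 (1 : ℂ)).image φ) :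
          Finset (ℂ × ℂ × ℂ)) : Set (ℂ × ℂ × ℂ)) := by
    ext ⟨u, v, n⟩
    simp only [Set.mem_ofPred_eq, Finset.mem_coe, Finset.mem_insert, Finset.mem_image,
      Finset.mem_product, hs', hm, hφ, Prod.mk.injEq, Prod.exists]
    constructor
    · intro h
      rcases h.cases with h | ⟨c, ζ, h1, h2, h3, h4⟩
      · exact Or.inl h
      · exact Or.inr ⟨c, n, ζ, ⟨h1, h2⟩, h3.symm, h4.symm, rfl⟩
    · rintro (⟨rfl, rfl, rfl⟩ | ⟨c, n, ζ, ⟨h1, h2⟩, rfl, rfl, rfl⟩)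
      · exact Sing.of_axis
      · exact Sing.of_base h1 h2
  rw [hset, Set.ncard_coe_finset, Finset.card_insert_of_notMem, Finset.card_image_of_injOn,
    Finset.card_product, hs, hζ]
  · rintro ⟨⟨c, n⟩, ζ⟩ h ⟨⟨c', n'⟩, ζ'⟩ h' he
    simp only [Finset.coe_product, Set.mem_prod, Finset.mem_coe, hs', hm] at h h'
    simp only [hφ, Prod.mk.injEq] at he
    obtain ⟨e1, e2, e3⟩ := he
    have hc := h.1.ne
    have z0 : ζ ≠ 0 := by
      intro h0; rw [h0] at h; norm_num at h
    have z0' : ζ' ≠ 0 := by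
      intro h0; rw [h0] at h'; norm_num at h'
    have hc' : c' ≠ 0 := h'.1.ne
    -- recover `c` as `u ^ 4 / v ^ 3`
    have k : ∀ c z : ℂ, c ≠ 0 → z ^ 7 = 1 → (c * z ^ 6) ^ 3 * c = (c * z) ^ 4 := by
      intro c z _ hz
      linear_combination c ^ 4 * z ^ 4 * (z ^ 7 + 1) * hz
    have k1 := k c ζ hc h.2
    have k2 := k c' ζ' hc' h'.2
    rw [e1, e2, ← k2] at k1
    have hcc : c = c' := mul_left_cancel₀ (pow_ne_zero _ (mul_ne_zero hc' (pow_ne_zero _ z0'))) k1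
    subst hcc
    have := mul_left_cancel₀ hc e1
    rw [this, e3]
  · simp only [Finset.mem_image, Finset.mem_product, hs', hm, hφ, Prod.mk.injEq, not_exists,
      not_and, Prod.forall]
    intro c n ζ ⟨h1, h2⟩ h3
    exfalso
    rcases mul_eq_zero.mp h3 with h | h
    · exact h1.ne h
    · rw [h] at h2; norm_num at h2

lemma Sing.z_ne {u v z n : ℂ} (h : Sing u v z n) (h0 : ¬ (u = 0 ∧ v = 0 ∧ z = 0 ∧ n = 0)) :
    z ≠ 0 := by
  rintro rfl
  obtain ⟨h1, h2, -, h4⟩ := h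
  apply h0
  have huv : Gs (u * v) 0 n = 0 → u = 0 ∧ v = 0 := by
    intro hg
    rw [hg] at h1 h2
    simpa using And.intro h1 h2
  by_cases hn : n = 0
  · subst hn
    obtain ⟨rfl, rfl⟩ := huv (by simp [Gs])
    exact ⟨rfl, rfl, rfl, rfl⟩
  exfalso
  by_cases hR : RR (u * v) 0 n = 0
  · obtain ⟨rfl, rfl⟩ := huv (by simp [Gs, hR])
    simp [RR, hn] at hR
  have e := (mul_eq_zero.mp (neg_eq_zero.mp h4)).resolve_left hR
  have e' : n * (3 * (u * v) - 8 * n ^ 2) = 0 := by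
    unfold RR RRn at e; linear_combination e / 7
  have e2 := (mul_eq_zero.mp e').resolve_left hn
  have e3 : u * v = 8 / 3 * n ^ 2 := by linear_combination e2 / 3
  have e4 : 49 * (u * v) ^ 6 - 4 * (u * v) * Gs (u * v) 0 n ^ 2 = 0 := by
    linear_combination 7 * v ^ 6 * h1 - 2 * v * Gs (u * v) 0 n * h2
  rw [e3] at e4
  unfold Gs RR at e4
  have e5 : n ^ 12 = 0 := by
    have : (49 * (8 / 3) ^ 6 - 4 * (8 / 3) * (14 * (32 / 3)) ^ 2 : ℂ) * n ^ 12 = 0 := by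
      linear_combination e4
    exact (mul_eq_zero.mp this).resolve_left (by norm_num)
  exact hn (pow_eq_zero_iff (by norm_num) |>.mp e5)

lemma Sing.smul {u v z n t : ℂ} (h : Sing u v z n) : Sing (t * u) (t * v) (t * z) (t * n) := by
  obtain ⟨h1, h2, h3, h4⟩ := h
  unfold Sing Gz Gn Gs RRz RRn RR at *
  refine ⟨?_, ?_, ?_, ?_⟩
  · linear_combination t ^ 6 * h1
  · linear_combination t ^ 6 * h2
  · linear_combination t ^ 6 * h3
  · linear_combination t ^ 6 * h4

/-! ### Partial derivatives -/

noncomputable def nP (b : ℂ) : MvPolynomial (Fin 4) ℂ := C b * (X 2 + X 3)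
noncomputable def sP : MvPolynomial (Fin 4) ℂ := X 0 ^ 2 + X 1 ^ 2
noncomputable def RP (b : ℂ) : MvPolynomial (Fin 4) ℂ :=
  C 7 * nP b * sP - C 8 * nP b ^ 3 - C 4 * nP b ^ 2 * X 2 + C 4 * nP b * X 2 ^ 2 + C 8 * X 2 ^ 3
noncomputable def AP : MvPolynomial (Fin 4) ℂ :=
  X 0 ^ 7 - C 21 * X 0 ^ 5 * X 1 ^ 2 + C 35 * X 0 ^ 3 * X 1 ^ 4 - C 7 * X 0 * X 1 ^ 6
noncomputable def BP : MvPolynomial (Fin 4) ℂ :=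
  C 7 * X 2 * (sP ^ 3 - C 8 * X 2 ^ 2 * sP ^ 2 + C 16 * X 2 ^ 4 * sP) - C 64 * X 2 ^ 7
/-- The septic after the substitution `n = b (z + w)`. -/
noncomputable def SP (b : ℂ) : MvPolynomial (Fin 4) ℂ := AP + BP - (nP b - X 2) * RP b ^ 2

noncomputable def RPn (b : ℂ) : MvPolynomial (Fin 4) ℂ :=
  C 7 * sP - C 24 * nP b ^ 2 - C 8 * nP b * X 2 + C 4 * X 2 ^ 2
noncomputable def RPz (b : ℂ) : MvPolynomial (Fin 4) ℂ :=
  - C 4 * nP b ^ 2 + C 8 * nP b * X 2 + C 24 * X 2 ^ 2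
noncomputable def GPs (b : ℂ) : MvPolynomial (Fin 4) ℂ :=
  C 7 * X 2 * (C 3 * sP ^ 2 - C 16 * X 2 ^ 2 * sP + C 16 * X 2 ^ 4)
    - C 14 * nP b * (nP b - X 2) * RP b
noncomputable def GPn (b : ℂ) : MvPolynomial (Fin 4) ℂ :=
  -(RP b * (RP b + C 2 * (nP b - X 2) * RPn b))

lemma pd_nP (b : ℂ) (i : Fin 4) :
    pderiv i (nP b) = C (if i = 2 ∨ i = 3 then b else 0) := by
  fin_cases i <;> simp [nP, pderiv_X]

lemma pd_sP (i : Fin 4) :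
    pderiv i sP = if i = 0 then C 2 * X 0 else if i = 1 then C 2 * X 1 else 0 := by
  have h2 : (2 : MvPolynomial (Fin 4) ℂ) = C 2 := (map_ofNat C 2).symm
  fin_cases i <;> simp [sP, pderiv_X, Derivation.leibniz_pow, ← h2]

lemma pd_X (i j : Fin 4) : pderiv i (X j : MvPolynomial (Fin 4) ℂ) = if i = j then 1 else 0 := by
  rw [pderiv_X, Pi.single_apply]; simp [eq_comm]

lemma ev_nP (b : ℂ) (v : Fin 4 → ℂ) : eval v (nP b) = b * (v 2 + v 3) := by simp [nP]
lemma ev_sP (v : Fin 4 → ℂ) : eval v sP = v 0 ^ 2 + v 1 ^ 2 := by simp [sP]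
lemma ev_RP (b : ℂ) (v : Fin 4 → ℂ) :
    eval v (RP b) = RR (v 0 ^ 2 + v 1 ^ 2) (v 2) (b * (v 2 + v 3)) := by
  simp only [RP, RR, map_add, map_sub, map_mul, map_pow, eval_C, eval_X, ev_nP, ev_sP]
lemma ev_RPn (b : ℂ) (v : Fin 4 → ℂ) :
    eval v (RPn b) = RRn (v 0 ^ 2 + v 1 ^ 2) (v 2) (b * (v 2 + v 3)) := by
  simp only [RPn, RRn, map_add, map_sub, map_mul, map_pow, eval_C, eval_X, ev_nP, ev_sP]
lemma ev_GPs (b : ℂ) (v : Fin 4 → ℂ) :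
    eval v (GPs b) = Gs (v 0 ^ 2 + v 1 ^ 2) (v 2) (b * (v 2 + v 3)) := by
  simp only [GPs, Gs, map_add, map_sub, map_mul, map_pow, eval_C, eval_X, ev_nP, ev_sP, ev_RP]
lemma ev_GPn (b : ℂ) (v : Fin 4 → ℂ) :
    eval v (GPn b) = Gn (v 0 ^ 2 + v 1 ^ 2) (v 2) (b * (v 2 + v 3)) := by
  simp only [GPn, Gn, map_add, map_sub, map_mul, map_pow, map_neg, eval_C, eval_X, ev_nP,
    ev_RP, ev_RPn]

lemma pd0 (b : ℂ) : pderiv 0 (SP b) = C 7 * (X 0 ^ 6 - C 15 * X 0 ^ 4 * X 1 ^ 2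
    + C 15 * X 0 ^ 2 * X 1 ^ 4 - X 1 ^ 6) + C 2 * X 0 * GPs b := by
  apply MvPolynomial.funext
  intro v
  simp [SP, AP, BP, RP, GPs, Derivation.leibniz, Derivation.leibniz_pow, pd_X, pd_nP, pd_sP]
  ring

lemma pd1 (b : ℂ) : pderiv 1 (SP b) = C 7 * (-C 6 * X 0 ^ 5 * X 1 + C 20 * X 0 ^ 3 * X 1 ^ 3
    - C 6 * X 0 * X 1 ^ 5) + C 2 * X 1 * GPs b := by
  apply MvPolynomial.funext
  intro v
  simp [SP, AP, BP, RP, GPs, Derivation.leibniz, Derivation.leibniz_pow, pd_X, pd_nP, pd_sP]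
  ring

lemma pd3 (b : ℂ) : pderiv 3 (SP b) = C b * GPn b := by
  apply MvPolynomial.funext
  intro v
  simp [SP, AP, BP, RP, RPn, GPn, Derivation.leibniz, Derivation.leibniz_pow, pd_X, pd_nP, pd_sP]
  ring

lemma ev_pd2 (b : ℂ) (v : Fin 4 → ℂ) : eval v (pderiv 2 (SP b)) =
    Gz (v 0 ^ 2 + v 1 ^ 2) (v 2) (b * (v 2 + v 3))
      + b * Gn (v 0 ^ 2 + v 1 ^ 2) (v 2) (b * (v 2 + v 3)) := by
  simp [SP, AP, BP, RP, Derivation.leibniz, Derivation.leibniz_pow, pd_X, pd_nP, pd_sP, ev_nP,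
    ev_sP, Gz, Gn, RR, RRn, RRz]
  ring
lemma ev_pd0 (b : ℂ) (v : Fin 4 → ℂ) : eval v (pderiv 0 (SP b)) =
    7 * (v 0 ^ 6 - 15 * v 0 ^ 4 * v 1 ^ 2 + 15 * v 0 ^ 2 * v 1 ^ 4 - v 1 ^ 6)
      + 2 * v 0 * Gs (v 0 ^ 2 + v 1 ^ 2) (v 2) (b * (v 2 + v 3)) := by
  rw [pd0]
  simp only [map_add, map_sub, map_mul, map_pow, map_neg, eval_C, eval_X, ev_GPs]
lemma ev_pd1 (b : ℂ) (v : Fin 4 → ℂ) : eval v (pderiv 1 (SP b)) =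
    7 * (-6 * v 0 ^ 5 * v 1 + 20 * v 0 ^ 3 * v 1 ^ 3 - 6 * v 0 * v 1 ^ 5)
      + 2 * v 1 * Gs (v 0 ^ 2 + v 1 ^ 2) (v 2) (b * (v 2 + v 3)) := by
  rw [pd1]
  simp only [map_add, map_sub, map_mul, map_pow, map_neg, eval_C, eval_X, ev_GPs]
lemma ev_pd3 (b : ℂ) (v : Fin 4 → ℂ) : eval v (pderiv 3 (SP b)) =
    b * Gn (v 0 ^ 2 + v 1 ^ 2) (v 2) (b * (v 2 + v 3)) := by
  rw [pd3]
  simp only [map_mul, eval_C, ev_GPn]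

section Second
variable (b : ℂ) (v : Fin 4 → ℂ)

lemma ev_GPs0 : eval v (pderiv 0 (GPs b)) =
    2 * v 0 * Gss (v 0 ^ 2 + v 1 ^ 2) (v 2) (b * (v 2 + v 3)) := by
  simp [GPs, RP, Derivation.leibniz, Derivation.leibniz_pow, pd_X, pd_nP, pd_sP, ev_nP,
    ev_sP, Gss]
  ring
lemma ev_GPs1 : eval v (pderiv 1 (GPs b)) =
    2 * v 1 * Gss (v 0 ^ 2 + v 1 ^ 2) (v 2) (b * (v 2 + v 3)) := by
  simp [GPs, RP, Derivation.leibniz, Derivation.leibniz_pow, pd_X, pd_nP, pd_sP, ev_nP,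
    ev_sP, Gss]
  ring
lemma ev_GPs3 : eval v (pderiv 3 (GPs b)) =
    b * Gsn (v 0 ^ 2 + v 1 ^ 2) (v 2) (b * (v 2 + v 3)) := by
  simp [GPs, RP, Derivation.leibniz, Derivation.leibniz_pow, pd_X, pd_nP, pd_sP, ev_nP,
    ev_sP, Gsn, RR, RRn]
  ring
lemma ev_GPn0 : eval v (pderiv 0 (GPn b)) =
    2 * v 0 * Gsn (v 0 ^ 2 + v 1 ^ 2) (v 2) (b * (v 2 + v 3)) := by
  simp [GPn, RPn, RP, Derivation.leibniz, Derivation.leibniz_pow, pd_X, pd_nP, pd_sP, ev_nP,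
    ev_sP, Gsn, RR, RRn]
  ring
lemma ev_GPn1 : eval v (pderiv 1 (GPn b)) =
    2 * v 1 * Gsn (v 0 ^ 2 + v 1 ^ 2) (v 2) (b * (v 2 + v 3)) := by
  simp [GPn, RPn, RP, Derivation.leibniz, Derivation.leibniz_pow, pd_X, pd_nP, pd_sP, ev_nP,
    ev_sP, Gsn, RR, RRn]
  ring
lemma ev_GPn3 : eval v (pderiv 3 (GPn b)) =
    b * Gnn (v 0 ^ 2 + v 1 ^ 2) (v 2) (b * (v 2 + v 3)) := by
  simp [GPn, RPn, RP, Derivation.leibniz, Derivation.leibniz_pow, pd_X, pd_nP, pd_sP, ev_nP,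
    ev_sP, Gnn, RR, RRn]
  ring

end Second

/-! ### Rank of the Hessian -/

lemma rank_eq_three (H : Matrix (Fin 4) (Fin 4) ℂ) (v : Fin 4 → ℂ) (hv : v ≠ 0)
    (hH : H.mulVec v = 0) (hd : (H.submatrix ![0, 1, 3] ![0, 1, 3]).det ≠ 0) : H.rank = 3 := by
  apply le_antisymm
  · have h1 := LinearMap.finrank_range_add_finrank_ker H.mulVecLin
    rw [Module.finrank_fin_fun] at h1
    have h2 : 0 < Module.finrank ℂ (LinearMap.ker H.mulVecLin) := by
      rw [Module.finrank_pos_iff_exists_ne_zero]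
      refine ⟨⟨v, by simpa using hH⟩, ?_⟩
      intro h
      exact hv (by simpa using congrArg Subtype.val h)
    unfold Matrix.rank
    omega
  · have h1 := Matrix.rank_of_det_ne_zero hd
    have h2 := Matrix.rank_submatrix_le H ![0, 1, 3] ![0, 1, 3]
    rw [h1] at h2
    simpa using h2

lemma euler (b : ℂ) : ∑ i, X i * pderiv i (SP b) = C 7 * SP b := by
  apply MvPolynomial.funext
  intro v
  rw [Fin.sum_univ_four]
  simp only [map_add, map_mul, eval_X, ev_pd0, ev_pd1, ev_pd2, ev_pd3, eval_C]
  simp only [SP, AP, BP, map_add, map_sub, map_mul, map_pow, eval_C, eval_X, ev_RP, ev_nP, ev_sP]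
  unfold Gz Gn Gs RRz RRn RR
  ring

lemma hess_mulVec (b : ℂ) (v : Fin 4 → ℂ) (h : VanishingJacobianAt (SP b) v) :
    (hessianAt (SP b) v).mulVec v = 0 := by
  funext j
  have h1 := congrArg (fun q => eval v (pderiv j q)) (euler b)
  simp only [map_sum, Derivation.leibniz, smul_eq_mul, map_add, map_mul, eval_X, eval_C,
    derivation_C, Finset.sum_add_distrib, pd_X, mul_zero, add_zero] at h1
  simp only [h _, zero_mul, mul_zero, Finset.sum_const_zero, add_zero] at h1
  simp only [Matrix.mulVec, dotProduct, hessianAt, Matrix.of_apply, Pi.zero_apply]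
  rw [← h1]
  exact Finset.sum_congr rfl fun i _ => mul_comm _ _

lemma minor_eq (b : ℂ) (v : Fin 4 → ℂ) {s t gs gss gsn gnn : ℂ}
    (hs : v 0 ^ 2 + v 1 ^ 2 = s)
    (ht : v 0 ^ 7 - 21 * v 0 ^ 5 * v 1 ^ 2 + 35 * v 0 ^ 3 * v 1 ^ 4 - 7 * v 0 * v 1 ^ 6 = t)
    (hgs : Gs s (v 2) (b * (v 2 + v 3)) = gs) (hgss : Gss s (v 2) (b * (v 2 + v 3)) = gss)
    (hgsn : Gsn s (v 2) (b * (v 2 + v 3)) = gsn) (hgnn : Gnn s (v 2) (b * (v 2 + v 3)) = gnn) :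
    ((hessianAt (SP b) v).submatrix ![0, 1, 3] ![0, 1, 3]).det =
      b ^ 2 * (gnn * (4 * gs ^ 2 + 8 * gs * gss * s - 1764 * s ^ 5 - 168 * gss * t)
        - 4 * gsn ^ 2 * (-42 * t + 2 * gs * s)) := by
  have e00 : eval v (pderiv 0 (pderiv 0 (SP b))) = 42 * (v 0 ^ 5 - 10 * v 0 ^ 3 * v 1 ^ 2
      + 5 * v 0 * v 1 ^ 4) + 2 * gs + 4 * v 0 ^ 2 * gss := by
    rw [pd0]
    simp [Derivation.leibniz, Derivation.leibniz_pow, pd_X, ev_GPs, ev_GPs0, hs, hgs, hgss]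
    ring
  have e10 : eval v (pderiv 1 (pderiv 0 (SP b))) = -42 * (5 * v 0 ^ 4 * v 1
      - 10 * v 0 ^ 2 * v 1 ^ 3 + v 1 ^ 5) + 4 * v 0 * v 1 * gss := by
    rw [pd0]
    simp [Derivation.leibniz, Derivation.leibniz_pow, pd_X, ev_GPs, ev_GPs1, hs, hgs, hgss]
    ring
  have e30 : eval v (pderiv 3 (pderiv 0 (SP b))) = 2 * v 0 * b * gsn := by
    rw [pd0]
    simp [Derivation.leibniz, Derivation.leibniz_pow, pd_X, ev_GPs3, hs, hgsn]
    ring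
  have e01 : eval v (pderiv 0 (pderiv 1 (SP b))) = -42 * (5 * v 0 ^ 4 * v 1
      - 10 * v 0 ^ 2 * v 1 ^ 3 + v 1 ^ 5) + 4 * v 0 * v 1 * gss := by
    rw [pd1]
    simp [Derivation.leibniz, Derivation.leibniz_pow, pd_X, ev_GPs, ev_GPs0, hs, hgs, hgss]
    ring
  have e11 : eval v (pderiv 1 (pderiv 1 (SP b))) = -42 * (v 0 ^ 5 - 10 * v 0 ^ 3 * v 1 ^ 2
      + 5 * v 0 * v 1 ^ 4) + 2 * gs + 4 * v 1 ^ 2 * gss := by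
    rw [pd1]
    simp [Derivation.leibniz, Derivation.leibniz_pow, pd_X, ev_GPs, ev_GPs1, hs, hgs, hgss]
    ring
  have e31 : eval v (pderiv 3 (pderiv 1 (SP b))) = 2 * v 1 * b * gsn := by
    rw [pd1]
    simp [Derivation.leibniz, Derivation.leibniz_pow, pd_X, ev_GPs3, hs, hgsn]
    ring
  have e03 : eval v (pderiv 0 (pderiv 3 (SP b))) = 2 * v 0 * b * gsn := by
    rw [pd3]
    simp [Derivation.leibniz, ev_GPn0, hs, hgsn]
    ring
  have e13 : eval v (pderiv 1 (pderiv 3 (SP b))) = 2 * v 1 * b * gsn := by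
    rw [pd3]
    simp [Derivation.leibniz, ev_GPn1, hs, hgsn]
    ring
  have e33 : eval v (pderiv 3 (pderiv 3 (SP b))) = b ^ 2 * gnn := by
    rw [pd3]
    simp [Derivation.leibniz, ev_GPn3, hs, hgnn]
    ring
  rw [Matrix.det_fin_three]
  simp only [Matrix.submatrix_apply, hessianAt, Matrix.of_apply, Matrix.cons_val_zero,
    Matrix.cons_val_one, Matrix.cons_val, e00, e10, e30, e01, e11, e31, e03, e13, e33]
  clear e00 e10 e30 e01 e11 e31 e03 e13 e33 hgs hgss hgsn hgnn
  subst hs ht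
  ring

/-! ### The gradient in the coordinates `u, v, z, n` -/

lemma I_pow_facts : Complex.I ^ 2 = -1 ∧ Complex.I ^ 3 = -Complex.I ∧ Complex.I ^ 4 = 1 ∧
    Complex.I ^ 5 = Complex.I ∧ Complex.I ^ 6 = -1 := by
  have h := Complex.I_sq
  refine ⟨h, ?_, ?_, ?_, ?_⟩
  · linear_combination Complex.I * h
  · linear_combination (Complex.I ^ 2 - 1) * h
  · linear_combination Complex.I * (Complex.I ^ 2 - 1) * h
  · linear_combination (Complex.I ^ 4 - Complex.I ^ 2 + 1) * h

lemma jac_iff {b : ℂ} (hb : b ≠ 0) (v : Fin 4 → ℂ) : VanishingJacobianAt (SP b) v ↔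
    Sing (v 0 + Complex.I * v 1) (v 0 - Complex.I * v 1) (v 2) (b * (v 2 + v 3)) := by
  obtain ⟨h2, h3, h4, h5, h6⟩ := I_pow_facts
  have hs : (v 0 + Complex.I * v 1) * (v 0 - Complex.I * v 1) = v 0 ^ 2 + v 1 ^ 2 := by
    linear_combination (-v 1 ^ 2) * h2
  have hu : (v 0 + Complex.I * v 1) ^ 6 = (v 0 ^ 6 - 15 * v 0 ^ 4 * v 1 ^ 2
      + 15 * v 0 ^ 2 * v 1 ^ 4 - v 1 ^ 6) - Complex.I * (-6 * v 0 ^ 5 * v 1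
      + 20 * v 0 ^ 3 * v 1 ^ 3 - 6 * v 0 * v 1 ^ 5) := by
    linear_combination 15 * v 0 ^ 4 * v 1 ^ 2 * h2 + 20 * v 0 ^ 3 * v 1 ^ 3 * h3
      + 15 * v 0 ^ 2 * v 1 ^ 4 * h4 + 6 * v 0 * v 1 ^ 5 * h5 + v 1 ^ 6 * h6
  have hv : (v 0 - Complex.I * v 1) ^ 6 = (v 0 ^ 6 - 15 * v 0 ^ 4 * v 1 ^ 2
      + 15 * v 0 ^ 2 * v 1 ^ 4 - v 1 ^ 6) + Complex.I * (-6 * v 0 ^ 5 * v 1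
      + 20 * v 0 ^ 3 * v 1 ^ 3 - 6 * v 0 * v 1 ^ 5) := by
    linear_combination 15 * v 0 ^ 4 * v 1 ^ 2 * h2 - 20 * v 0 ^ 3 * v 1 ^ 3 * h3
      + 15 * v 0 ^ 2 * v 1 ^ 4 * h4 - 6 * v 0 * v 1 ^ 5 * h5 + v 1 ^ 6 * h6
  unfold VanishingJacobianAt Sing
  rw [hs, hu, hv, Fin.forall_fin_succ, Fin.forall_fin_succ, Fin.forall_fin_succ,
    Fin.forall_fin_succ]
  have f2 : (Fin.succ (Fin.succ 0) : Fin 4) = 2 := rfl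
  have f3 : (Fin.succ (Fin.succ 1) : Fin 4) = 3 := rfl
  have f4 : (Fin.succ 1 : Fin 4) = 2 := rfl
  simp only [Fin.succ_zero_eq_one, f2, f3, f4, ev_pd0, ev_pd1, ev_pd2, ev_pd3, IsEmpty.forall_iff,
    and_true]
  generalize Gs (v 0 ^ 2 + v 1 ^ 2) (v 2) (b * (v 2 + v 3)) = g
  generalize Gn (v 0 ^ 2 + v 1 ^ 2) (v 2) (b * (v 2 + v 3)) = gn
  generalize Gz (v 0 ^ 2 + v 1 ^ 2) (v 2) (b * (v 2 + v 3)) = gz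
  constructor
  · rintro ⟨k0, k1, k2, k3⟩
    refine ⟨?_, ?_, ?_, ?_⟩
    · linear_combination k0 - Complex.I * k1
    · linear_combination k0 + Complex.I * k1
    · linear_combination k2 - k3
    · exact (mul_eq_zero.1 k3).resolve_left hb
  · rintro ⟨k0, k1, k2, k3⟩
    refine ⟨?_, ?_, ?_, ?_⟩
    · linear_combination (k0 + k1) / 2
    · linear_combination Complex.I / 2 * (k0 - k1) - (7 * (-6 * v 0 ^ 5 * v 1
        + 20 * v 0 ^ 3 * v 1 ^ 3 - 6 * v 0 * v 1 ^ 5) + 2 * v 1 * g) * (-1) * h2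
    · linear_combination k2 + b * k3
    · rw [k3, mul_zero]

/-! ### The points -/

noncomputable def pt (b : ℂ) (p : ℂ × ℂ × ℂ) : Fin 4 → ℂ :=
  ![(p.1 + p.2.1) / 2, -(Complex.I * (p.1 - p.2.1) / 2), 1, p.2.2 / b - 1]

lemma pt_ne (b : ℂ) (p : ℂ × ℂ × ℂ) : pt b p ≠ 0 := fun h => by
  have := congrFun h 2
  simp [pt] at this

lemma pt_u (b : ℂ) (p : ℂ × ℂ × ℂ) : pt b p 0 + Complex.I * pt b p 1 = p.1 := by
  simp only [pt, Matrix.cons_val_zero, Matrix.cons_val_one]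
  linear_combination (-(p.1 - p.2.1) / 2) * Complex.I_sq
lemma pt_v (b : ℂ) (p : ℂ × ℂ × ℂ) : pt b p 0 - Complex.I * pt b p 1 = p.2.1 := by
  simp only [pt, Matrix.cons_val_zero, Matrix.cons_val_one]
  linear_combination ((p.1 - p.2.1) / 2) * Complex.I_sq
lemma pt_z (b : ℂ) (p : ℂ × ℂ × ℂ) : pt b p 2 = 1 := by simp [pt]
lemma pt_n {b : ℂ} (hb : b ≠ 0) (p : ℂ × ℂ × ℂ) : b * (pt b p 2 + pt b p 3) = p.2.2 := by
  simp [pt]; field_simp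

lemma jac_pt {b : ℂ} (hb : b ≠ 0) (p : ℂ × ℂ × ℂ) :
    VanishingJacobianAt (SP b) (pt b p) ↔ Sing p.1 p.2.1 1 p.2.2 := by
  rw [jac_iff hb, pt_u, pt_v, pt_n hb, pt_z]

lemma sing_eq_image {b : ℂ} (hb : b ≠ 0) :
    {p : Projectivization ℂ (Fin 4 → ℂ) | IsSingularPoint (SP b) p} =
      (fun q => Projectivization.mk ℂ (pt b q) (pt_ne b q)) ''
        {p : ℂ × ℂ × ℂ | Sing p.1 p.2.1 1 p.2.2} := by
  ext p
  constructor
  · rintro ⟨v, hv, rfl, hj⟩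
    rw [jac_iff hb] at hj
    have hz : v 2 ≠ 0 := by
      apply hj.z_ne
      rintro ⟨k1, k2, k3, k4⟩
      apply hv
      have h0 : v 0 = 0 := by linear_combination (k1 + k2) / 2
      have h1 : v 1 = 0 := by
        linear_combination (-Complex.I / 2) * (k1 - k2) + v 1 * Complex.I_sq
      have h3 : v 3 = 0 := by
        have := (mul_eq_zero.1 k4).resolve_left hb
        rwa [k3, zero_add] at this
      funext i
      fin_cases i
      · exact h0
      · exact h1
      · exact k3
      · exact h3
    have hj' := hj.smul (t := (v 2)⁻¹)
    rw [inv_mul_cancel₀ hz] at hj'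
    refine ⟨((v 2)⁻¹ * (v 0 + Complex.I * v 1), (v 2)⁻¹ * (v 0 - Complex.I * v 1),
      (v 2)⁻¹ * (b * (v 2 + v 3))), hj', ?_⟩
    rw [Projectivization.mk_eq_mk_iff']
    refine ⟨(v 2)⁻¹, ?_⟩
    funext i
    fin_cases i
    · simp [pt]; ring
    · simp [pt]
      linear_combination ((v 2)⁻¹ * v 1) * Complex.I_sq
    · simp [pt, hz]
    · simp [pt]; field_simp; ring
  · rintro ⟨q, hq, rfl⟩
    exact ⟨pt b q, pt_ne b q, rfl, (jac_pt hb q).2 hq⟩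

lemma pt_inj {b : ℂ} (hb : b ≠ 0) :
    Function.Injective (fun q => Projectivization.mk ℂ (pt b q) (pt_ne b q)) := by
  intro p q h
  rw [Projectivization.mk_eq_mk_iff'] at h
  obtain ⟨a, ha⟩ := h
  have h2 := congrFun ha 2
  rw [Pi.smul_apply, pt_z, pt_z, smul_eq_mul, mul_one] at h2
  rw [h2, one_smul] at ha
  have e1 := pt_u b p
  have e2 := pt_v b p
  have e3 := pt_n hb p
  rw [← ha] at e1 e2 e3
  rw [pt_u] at e1
  rw [pt_v] at e2
  rw [pt_n hb] at e3
  exact Prod.ext e1.symm (Prod.ext e2.symm e3.symm)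

lemma pt_rank {b : ℂ} (hb : b ≠ 0) (p : ℂ × ℂ × ℂ) (h : Sing p.1 p.2.1 1 p.2.2) :
    (hessianAt (SP b) (pt b p)).rank = 3 := by
  apply rank_eq_three _ (pt b p) (pt_ne b p) (hess_mulVec b _ ((jac_pt hb p).2 h))
  have hs : pt b p 0 ^ 2 + pt b p 1 ^ 2 = p.1 * p.2.1 := by
    rw [← pt_u b p, ← pt_v b p]
    linear_combination (pt b p 1) ^ 2 * Complex.I_sq
  have ht : pt b p 0 ^ 7 - 21 * pt b p 0 ^ 5 * pt b p 1 ^ 2 + 35 * pt b p 0 ^ 3 * pt b p 1 ^ 4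
      - 7 * pt b p 0 * pt b p 1 ^ 6 = (p.1 ^ 7 + p.2.1 ^ 7) / 2 := by
    obtain ⟨h2, h3, h4, h5, h6⟩ := I_pow_facts
    rw [← pt_u b p, ← pt_v b p]
    linear_combination -21 * pt b p 0 ^ 5 * pt b p 1 ^ 2 * h2
      - 35 * pt b p 0 ^ 3 * pt b p 1 ^ 4 * h4 - 7 * pt b p 0 * pt b p 1 ^ 6 * h6
  rw [minor_eq b (pt b p) hs ht rfl rfl rfl rfl, pt_n hb, pt_z]
  obtain ⟨u, v, n⟩ := p
  simp only at h ⊢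
  rcases h.cases with ⟨rfl, rfl, rfl⟩ | ⟨c, ζ, hbase, hζ, rfl, rfl⟩
  · have : b ^ 2 ≠ 0 := pow_ne_zero _ hb
    apply mul_ne_zero this
    norm_num [Gnn, Gs, Gsn, Gss, RR, RRn]
  · have hc := hbase.ne
    have huv : c * ζ * (c * ζ ^ 6) = c ^ 2 := by linear_combination c ^ 2 * hζ
    have hu7 : (c * ζ) ^ 7 = c ^ 7 := by rw [mul_pow, hζ, mul_one]
    have hv7 : (c * ζ ^ 6) ^ 7 = c ^ 7 := by
      rw [mul_pow, ← pow_mul, mul_comm 6 7, pow_mul, hζ]; ring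
    have hζ0 : ζ ≠ 0 := by rintro rfl; norm_num at hζ
    have hg : 2 * Gs (c ^ 2) 1 n = -7 * c ^ 5 := by
      have h1 := h.1
      rw [huv] at h1
      have h2 : c * ζ ^ 6 * (2 * Gs (c ^ 2) 1 n + 7 * c ^ 5) = 0 := by linear_combination h1
      have h3 := (mul_eq_zero.1 h2).resolve_left (mul_ne_zero hc (pow_ne_zero _ hζ0))
      linear_combination h3
    rw [huv, hu7, hv7]
    have hne := hess_ne hbase
    generalize Gs (c ^ 2) 1 n = gs at *
    generalize Gss (c ^ 2) 1 n = gss at *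
    generalize Gsn (c ^ 2) 1 n = gsn at *
    generalize Gnn (c ^ 2) 1 n = gnn at *
    have hgs : gs = -7 / 2 * c ^ 5 := by linear_combination hg / 2
    subst hgs
    have key := mul_ne_zero (mul_ne_zero (by norm_num : (-49 : ℂ) ≠ 0)
      (mul_ne_zero (pow_ne_zero 2 hb) (pow_ne_zero 7 hc))) hne
    intro h0
    apply key
    linear_combination h0

/-! ### Change of variables -/

lemma S_eq_SP {α b : ℂ} (hα : 7 * α ^ 3 + 7 * α + 1 = 0) (hb : 7 * α * b = -1) :
    Psept - Usept (-(12 / 7) * α ^ 2 - (384 / 49) * α - 8 / 7)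
      (-(32 / 7) * α ^ 2 + (24 / 49) * α - 4) (-4 * α ^ 2 + (24 / 49) * α - 4)
      (-(8 / 7) * α ^ 2 + (8 / 49) * α - 8 / 7) (49 * α ^ 2 - 7 * α + 50) = SP b := by
  have hb2 : b = α ^ 2 + 1 := by linear_combination b * hα - (α ^ 2 + 1) * hb
  have hα0 : α ≠ 0 := by rintro rfl; norm_num at hα
  apply MvPolynomial.funext
  intro v
  have hP : eval v Psept = eval v (AP + BP) := by
    simp [Psept, AP, BP, sP]
    ring
  have hU : ∀ a₁ a₂ a₃ a₄ a₅ : ℂ, eval v (Usept a₁ a₂ a₃ a₄ a₅) = (v 2 + a₅ * v 3) *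
      (a₁ * v 2 ^ 3 + a₂ * v 2 ^ 2 * v 3 + a₃ * v 2 * v 3 ^ 2 + a₄ * v 3 ^ 3
        + (v 2 + v 3) * (v 0 ^ 2 + v 1 ^ 2)) ^ 2 := by
    intros
    simp [Usept]
  rw [SP, map_sub, map_sub, map_mul, map_pow, hU, hP, ev_RP, map_sub, ev_nP, eval_X]
  congr 1
  subst hb2
  have hC : (-(12 / 7) * α ^ 2 - (384 / 49) * α - 8 / 7) * v 2 ^ 3
      + (-(32 / 7) * α ^ 2 + (24 / 49) * α - 4) * v 2 ^ 2 * v 3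
      + (-4 * α ^ 2 + (24 / 49) * α - 4) * v 2 * v 3 ^ 2
      + (-(8 / 7) * α ^ 2 + (8 / 49) * α - 8 / 7) * v 3 ^ 3
      + (v 2 + v 3) * (v 0 ^ 2 + v 1 ^ 2)
      = -α * RR (v 0 ^ 2 + v 1 ^ 2) (v 2) ((α ^ 2 + 1) * (v 2 + v 3)) := by
    unfold RR
    linear_combination ((v 2 + v 3) / 7 * (7 * (v 0 ^ 2 + v 1 ^ 2)
      - 8 * ((α ^ 2 + 1) * (v 2 + v 3)) ^ 2 - 4 * ((α ^ 2 + 1) * (v 2 + v 3)) * v 2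
      + 4 * v 2 ^ 2) + 8 / 49 * α * (v 2 + v 3) ^ 3) * hα
  have hB : α ^ 2 * (v 2 + (49 * α ^ 2 - 7 * α + 50) * v 3)
      = (α ^ 2 + 1) * (v 2 + v 3) - v 2 := by
    linear_combination (7 * α - 1) * v 3 * hα
  rw [hC, ← hB]
  ring

/-- For α ∈ ℂ with 7α³ + 7α + 1 = 0 and the parameters as in the
theorem, the septic surface {S_α = 0} ⊂ ℙ³(ℂ) has exactly 99 singular points,
all of which are nodes. -/
theorem septic_99_nodes (α : ℂ) (hα : 7 * α ^ 3 + 7 * α + 1 = 0)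
    (a₁ a₂ a₃ a₄ a₅ : ℂ)
    (ha₁ : a₁ = -(12 / 7) * α ^ 2 - (384 / 49) * α - 8 / 7)
    (ha₂ : a₂ = -(32 / 7) * α ^ 2 + (24 / 49) * α - 4)
    (ha₃ : a₃ = -4 * α ^ 2 + (24 / 49) * α - 4)
    (ha₄ : a₄ = -(8 / 7) * α ^ 2 + (8 / 49) * α - 8 / 7)
    (ha₅ : a₅ = 49 * α ^ 2 - 7 * α + 50)
    (S : MvPolynomial (Fin 4) ℂ) (hS : S = Psept - Usept a₁ a₂ a₃ a₄ a₅) :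
    {p : Projectivization ℂ (Fin 4 → ℂ) | IsSingularPoint S p}.ncard = 99 ∧
      ∀ p : Projectivization ℂ (Fin 4 → ℂ), IsSingularPoint S p → IsNode S p := by
  have hα0 : α ≠ 0 := by rintro rfl; norm_num at hα
  have hb : 7 * α * (-1 / (7 * α)) = -1 := by field_simp
  have hb0 : -1 / (7 * α) ≠ 0 := by
    intro h
    rw [h] at hb
    norm_num at hb
  subst ha₁ ha₂ ha₃ ha₄ ha₅
  rw [S_eq_SP hα hb] at hS
  subst hS
  constructor
  · rw [sing_eq_image hb0, Set.ncard_image_of_injective _ (pt_inj hb0), sing_ncard]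
  · intro p hp
    have hp' : p ∈ {p : Projectivization ℂ (Fin 4 → ℂ) | IsSingularPoint (SP (-1 / (7 * α))) p} := hp
    rw [sing_eq_image hb0] at hp'
    obtain ⟨q, hq, rfl⟩ := hp'
    exact ⟨pt _ q, pt_ne _ q, rfl, (jac_pt hb0 q).2 hq, pt_rank hb0 q hq⟩
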